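/- Let (Y, ℝ, α) be a one-parameter C*-dynamical system which is α-simple and satisfies sp(α) = Γ̃(α). If C is a nonzero α-invariant hereditary C*-subalgebra of Y and γ ∈ sp(α), then for every open neighborhood V of γ the closed linear span of Y^α(V) C Y^α(V)* equals Y. -/

import Mathlib

open MeasureTheory Set Filter Topology Pointwise

noncomputable section

namespace PeligradMax

variable {X : Type*} [NonUnitalNormedRing X] [StarRing X] [CStarRing X]
  [NormedSpace ℂ X] [IsScalarTower ℂ X X] [SMulCommClass ℂ X X] [StarModule ℂ X]
  [CompleteSpace X] [PartialOrder X] [StarOrderedRing X]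

/-- A one-parameter C*-dynamical system: a group of *-automorphisms of `X`
with norm-continuous orbit maps. -/
structure IsCStarDynSys (α : ℝ → X → X) : Prop where
  map_zero_time : ∀ x, α 0 x = x
  map_add_time : ∀ s t x, α (s + t) x = α s (α t x)
  map_add : ∀ t x y, α t (x + y) = α t x + α t y
  map_smulc : ∀ (t : ℝ) (c : ℂ) (x : X), α t (c • x) = c • α t x
  map_mul : ∀ t x y, α t (x * y) = α t x * α t y
  map_star : ∀ t x, α t (star x) = star (α t x)
  continuous_orbit : ∀ x, Continuous fun t => α t x

/-- Closed linear span. -/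
def ClosedSpan (S : Set X) : Set X := closure ((Submodule.span ℂ S : Submodule ℂ X) : Set X)

def MulSet2 (S T : Set X) : Set X := {z | ∃ s ∈ S, ∃ t ∈ T, z = s * t}

def MulSet3 (S T R : Set X) : Set X := {z | ∃ s ∈ S, ∃ t ∈ T, ∃ r ∈ R, z = s * t * r}

/-- Fourier transform of an integrable function. -/
def fourierT (f : ℝ → ℂ) (γ : ℝ) : ℂ := ∫ t : ℝ, f t * Complex.exp (-(Complex.I * γ * t))

/-- `α_f(x) = ∫ f(t) α_t(x) dt`. -/
def smear (α : ℝ → X → X) (f : ℝ → ℂ) (x : X) : X := ∫ t : ℝ, f t • α t x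

/-- Arveson spectrum of an element. -/
def elemSpec (α : ℝ → X → X) (x : X) : Set ℝ :=
  {γ | ∀ f : ℝ → ℂ, Integrable f → smear α f x = 0 → fourierT f γ = 0}

/-- Spectral subspace associated with a closed set `F ⊆ ℝ`. -/
def specC (α : ℝ → X → X) (F : Set ℝ) : Set X := {x | elemSpec α x ⊆ F}

/-- Spectral subspace of the subset `S` associated with an open set `U ⊆ ℝ`. -/
def specO (α : ℝ → X → X) (S : Set X) (U : Set ℝ) : Set X :=
  ClosedSpan {y | ∃ x ∈ S, ∃ f : ℝ → ℂ, Integrable f ∧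
    IsCompact (tsupport (fourierT f)) ∧ tsupport (fourierT f) ⊆ U ∧ y = smear α f x}

/-- The fixed point algebra `X^α`. -/
def fixedPts (α : ℝ → X → X) : Set X := {x | ∀ t, α t x = x}

/-- The Arveson spectrum of the action restricted to `S`. -/
def actSpec (α : ℝ → X → X) (S : Set X) : Set ℝ :=
  {γ : ℝ | ∀ ε > (0 : ℝ), S ∩ specC α (Icc (γ - ε) (γ + ε)) ≠ ({0} : Set X)}

def Invariant (α : ℝ → X → X) (S : Set X) : Prop := ∀ t : ℝ, ∀ x ∈ S, α t x ∈ S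

def IsSubalgebra (B : Set X) : Prop :=
  (0 : X) ∈ B ∧ (∀ x ∈ B, ∀ y ∈ B, x + y ∈ B) ∧
  (∀ c : ℂ, ∀ x ∈ B, c • x ∈ B) ∧ ∀ x ∈ B, ∀ y ∈ B, x * y ∈ B

def IsStarSubalgebra (B : Set X) : Prop := IsSubalgebra B ∧ ∀ x ∈ B, star x ∈ B

/-- `B` is a hereditary C*-subalgebra of the subset `S`. -/
def IsHereditaryIn (S B : Set X) : Prop :=
  B ⊆ S ∧ IsClosed B ∧ IsStarSubalgebra B ∧
  ∀ x ∈ S, ∀ b ∈ B, 0 ≤ x → x ≤ b → x ∈ B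

/-- `K` is a norm-closed two-sided ideal of the subset `S`. -/
def IsClosedTwoSidedIdealIn (S K : Set X) : Prop :=
  K ⊆ S ∧ IsClosed K ∧ (0 : X) ∈ K ∧ (∀ x ∈ K, ∀ y ∈ K, x + y ∈ K) ∧
  (∀ c : ℂ, ∀ x ∈ K, c • x ∈ K) ∧ ∀ s ∈ S, ∀ k ∈ K, s * k ∈ K ∧ k * s ∈ K

/-- `S` is `α`-simple: no nontrivial norm-closed `α`-invariant two-sided ideals. -/
def AlphaSimple (α : ℝ → X → X) (S : Set X) : Prop :=
  ∀ K : Set X, IsClosedTwoSidedIdealIn S K → Invariant α K → K = ({0} : Set X) ∨ K = S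

/-- The strong Arveson spectrum of the action restricted to `B`. -/
def strongSpec (α : ℝ → X → X) (B : Set X) : Set ℝ :=
  {γ : ℝ | ∀ ε > (0 : ℝ),
    ClosedSpan (MulSet3 (star '' (B ∩ specC α (Icc (γ - ε) (γ + ε)))) B
      (B ∩ specC α (Icc (γ - ε) (γ + ε)))) = B}

/-- The strong Connes spectrum of the action restricted to `S`. -/
def ConnesSpec (α : ℝ → X → X) (S : Set X) : Set ℝ :=
  ⋂ B ∈ {B : Set X | IsHereditaryIn S B ∧ B ≠ ({0} : Set X) ∧ Invariant α B},
    strongSpec α B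

def IsMaximalClosedSubalgebra (B : Set X) : Prop :=
  IsClosed B ∧ IsSubalgebra B ∧ B ≠ (univ : Set X) ∧
  ∀ W : Set X, IsClosed W → IsSubalgebra W → B ⊆ W → W = B ∨ W = univ

/-- The spectral Condition 4.3. -/
def Condition43 (α : ℝ → X → X) : Prop :=
  (∃ γ₀ : ℝ, 0 < γ₀ ∧ actSpec α (univ : Set X) = ({-γ₀, 0, γ₀} : Set ℝ) ∧
    IsClosedTwoSidedIdealIn (fixedPts α)
      (ClosedSpan (MulSet2 (specC α ({γ₀} : Set ℝ)) (star '' specC α ({γ₀} : Set ℝ)))) ∧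
    ∀ K : Set X,
      IsClosedTwoSidedIdealIn
        (ClosedSpan (MulSet2 (specC α ({γ₀} : Set ℝ)) (star '' specC α ({γ₀} : Set ℝ)))) K →
      K = ({0} : Set X) ∨
        K = ClosedSpan (MulSet2 (specC α ({γ₀} : Set ℝ)) (star '' specC α ({γ₀} : Set ℝ)))) ∨
  (∃ Y : Set X, IsClosedTwoSidedIdealIn (univ : Set X) Y ∧ Invariant α Y ∧ AlphaSimple α Y ∧
    specO α Y (Ioi (0 : ℝ)) = specO α (univ : Set X) (Ioi (0 : ℝ)) ∧
    actSpec α Y = ConnesSpec α Y ∧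
    closure (Y + specC α (Ici (0 : ℝ))) = (univ : Set X))

set_option linter.unusedSectionVars false

open scoped SchwartzMap ContDiff FourierTransform

/-- Smooth compactly supported functions on the line. -/
structure IsTest (φ : ℝ → ℂ) : Prop where
  smooth : ContDiff ℝ ∞ φ
  compact : HasCompactSupport φ

/-- The inverse Fourier transform matching the normalization of `fourierT`. -/
def kern (φ : ℝ → ℂ) (u : ℝ) : ℂ :=
  (2 * Real.pi : ℂ)⁻¹ * ∫ ξ : ℝ, φ ξ * Complex.exp (Complex.I * ξ * u)

lemma norm_exp_I_mul_mul (a b : ℝ) : ‖Complex.exp (Complex.I * a * b)‖ = 1 := by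
  rw [show Complex.I * a * b = ((a * b : ℝ) : ℂ) * Complex.I by push_cast; ring]
  exact Complex.norm_exp_ofReal_mul_I _

lemma norm_exp_neg_I_mul_mul (a b : ℝ) : ‖Complex.exp (-(Complex.I * a * b))‖ = 1 := by
  rw [show -(Complex.I * a * b) = ((-(a * b) : ℝ) : ℂ) * Complex.I by push_cast; ring]
  exact Complex.norm_exp_ofReal_mul_I _

lemma integrable_mul_exp {f : ℝ → ℂ} (hf : Integrable f) (u : ℝ) :
    Integrable fun ξ : ℝ => f ξ * Complex.exp (Complex.I * ξ * u) :=
  hf.mul_bdd (c := 1) (by fun_prop) (ae_of_all _ fun ξ => (norm_exp_I_mul_mul ξ u).le)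

lemma IsTest.continuous {φ : ℝ → ℂ} (h : IsTest φ) : Continuous φ := h.smooth.continuous

lemma IsTest.integrable {φ : ℝ → ℂ} (h : IsTest φ) : Integrable φ :=
  h.continuous.integrable_of_hasCompactSupport h.compact

lemma IsTest.mul_left {φ ψ : ℝ → ℂ} (hφ : ContDiff ℝ ∞ φ) (hψ : IsTest ψ) :
    IsTest fun ξ => φ ξ * ψ ξ :=
  ⟨hφ.mul hψ.smooth, hψ.compact.mul_left⟩

lemma IsTest.add {φ ψ : ℝ → ℂ} (hφ : IsTest φ) (hψ : IsTest ψ) :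
    IsTest fun ξ => φ ξ + ψ ξ :=
  ⟨hφ.smooth.add hψ.smooth, hφ.compact.add hψ.compact⟩

lemma IsTest.sub {φ ψ : ℝ → ℂ} (hφ : IsTest φ) (hψ : IsTest ψ) :
    IsTest fun ξ => φ ξ - ψ ξ := by
  refine ⟨hφ.smooth.sub hψ.smooth, ?_⟩
  simpa only [sub_eq_add_neg] using! hφ.compact.add hψ.compact.neg

lemma IsTest.comp_affine {φ : ℝ → ℂ} (hφ : IsTest φ) (γ : ℝ) {δ : ℝ} (hδ : 0 < δ) :
    IsTest fun ξ => φ ((ξ - γ) / δ) := by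
  refine ⟨hφ.smooth.comp (by fun_prop), ?_⟩
  exact hφ.compact.comp_homeomorph
    ((Homeomorph.subRight γ).trans (Homeomorph.mulRight₀ δ⁻¹ (inv_ne_zero hδ.ne')))

/-- `kern φ` is a Schwartz function with Fourier transform `φ`. -/
lemma IsTest.exists_schwartz {φ : ℝ → ℂ} (hφ : IsTest φ) :
    ∃ k : 𝓢(ℝ, ℂ), (k : ℝ → ℂ) = kern φ ∧ ∀ γ, fourierT k γ = φ γ := by
  have hpi : (0 : ℝ) < 2 * Real.pi := by positivity
  have h2 : IsTest fun ξ => φ ((ξ - 0) / (2 * Real.pi)⁻¹) := hφ.comp_affine 0 (by positivity)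
  let ψ : 𝓢(ℝ, ℂ) := h2.compact.toSchwartzMap h2.smooth
  have hψ : ∀ ξ, ψ ξ = φ (2 * Real.pi * ξ) := fun ξ => by
    change φ _ = _
    congr 1
    field_simp
    ring
  refine ⟨𝓕⁻ ψ, ?_, fun γ => ?_⟩
  · ext u
    rw [SchwartzMap.fourierInv_coe, Real.fourierInv_eq', kern]
    have h3 := Measure.integral_comp_mul_left
      (fun ξ : ℝ => φ ξ * Complex.exp (Complex.I * ξ * u)) (2 * Real.pi)
    rw [abs_of_pos (inv_pos.2 hpi), Complex.real_smul] at h3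
    push_cast at h3
    rw [← h3]
    congr 1
    ext v
    rw [hψ, smul_eq_mul, mul_comm]
    congr 2
    simp only [RCLike.inner_apply, conj_trivial]
    push_cast
    ring
  · have h4 : 𝓕 (𝓕⁻ ψ) (γ / (2 * Real.pi)) = ψ (γ / (2 * Real.pi)) := by
      rw [FourierTransform.fourier_fourierInv_eq]
    rw [SchwartzMap.fourier_coe, Real.fourier_real_eq_integral_exp_smul, hψ,
      mul_div_cancel₀ _ hpi.ne'] at h4
    rw [← h4, fourierT]
    congr 1
    ext v
    rw [smul_eq_mul, mul_comm]
    congr 2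
    push_cast
    field_simp

lemma IsTest.integrable_kern {φ : ℝ → ℂ} (hφ : IsTest φ) : Integrable (kern φ) := by
  obtain ⟨k, hk, -⟩ := hφ.exists_schwartz
  exact hk ▸ k.integrable

lemma IsTest.continuous_kern {φ : ℝ → ℂ} (hφ : IsTest φ) : Continuous (kern φ) := by
  obtain ⟨k, hk, -⟩ := hφ.exists_schwartz
  exact hk ▸ k.continuous

lemma IsTest.fourierT_kern {φ : ℝ → ℂ} (hφ : IsTest φ) : fourierT (kern φ) = φ := by
  obtain ⟨k, hk, h⟩ := hφ.exists_schwartz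
  exact hk ▸ funext h

lemma kern_add {φ ψ : ℝ → ℂ} (hφ : IsTest φ) (hψ : IsTest ψ) (u : ℝ) :
    kern (fun ξ => φ ξ + ψ ξ) u = kern φ u + kern ψ u := by
  simp only [kern, add_mul]
  rw [integral_add (integrable_mul_exp hφ.integrable u) (integrable_mul_exp hψ.integrable u),
    mul_add]

lemma kern_sub {φ ψ : ℝ → ℂ} (hφ : IsTest φ) (hψ : IsTest ψ) (u : ℝ) :
    kern (fun ξ => φ ξ - ψ ξ) u = kern φ u - kern ψ u := by
  simp only [kern, sub_mul]
  rw [integral_sub (integrable_mul_exp hφ.integrable u) (integrable_mul_exp hψ.integrable u),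
    mul_sub]

/-- Convolution with `kern φ` multiplies the Fourier transform by `φ`. -/
lemma integral_mul_kern_sub {f φ : ℝ → ℂ} (hf : Integrable f) (hφ : IsTest φ) (u : ℝ) :
    ∫ t, f t * kern φ (u - t) = kern (fun ξ => fourierT f ξ * φ ξ) u := by
  simp only [kern, fourierT]
  have h1 : ∀ t : ℝ, f t * ((2 * Real.pi : ℂ)⁻¹ *
        ∫ ξ : ℝ, φ ξ * Complex.exp (Complex.I * ξ * ((u - t : ℝ) : ℂ))) =
      (2 * Real.pi : ℂ)⁻¹ *
        ∫ ξ : ℝ, f t * (φ ξ * Complex.exp (Complex.I * ξ * ((u - t : ℝ) : ℂ))) := by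
    intro t
    rw [integral_const_mul]
    ring
  simp_rw [h1]
  rw [integral_const_mul, integral_integral_swap]
  · congr 2
    ext ξ
    rw [mul_assoc, ← integral_mul_const]
    congr 1
    ext t
    have : Complex.exp (Complex.I * ξ * ((u - t : ℝ) : ℂ)) =
        Complex.exp (-(Complex.I * ξ * t)) * Complex.exp (Complex.I * ξ * u) := by
      rw [← Complex.exp_add]
      congr 1
      push_cast
      ring
    rw [this]
    ring
  · have h2 := (hf.mul_prod hφ.integrable).mul_bdd (c := 1)
      (g := fun p : ℝ × ℝ => Complex.exp (Complex.I * p.2 * ((u - p.1 : ℝ) : ℂ)))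
      (by fun_prop) (ae_of_all _ fun p => (norm_exp_I_mul_mul _ _).le)
    refine h2.congr (ae_of_all _ fun p => ?_)
    simp only [Function.uncurry]
    ring

lemma kern_comp_affine (χ : ℝ → ℂ) (γ : ℝ) {δ : ℝ} (hδ : 0 < δ) (t : ℝ) :
    kern (fun ξ => χ ((ξ - γ) / δ)) t = δ * kern χ (δ * t) * Complex.exp (Complex.I * γ * t) := by
  simp only [kern]
  rw [← integral_sub_right_eq_self _ (-γ)]
  have h := Measure.integral_comp_mul_left (fun ξ : ℝ => χ ((ξ - -γ - γ) / δ) *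
    Complex.exp (Complex.I * ((ξ - -γ : ℝ) : ℂ) * t)) δ
  rw [abs_of_pos (inv_pos.2 hδ), Complex.real_smul] at h
  have hδ' : (δ : ℂ) ≠ 0 := by exact_mod_cast hδ.ne'
  rw [← mul_right_inj' (inv_ne_zero hδ')]
  push_cast at h ⊢
  rw [mul_left_comm, ← h, mul_assoc (δ : ℂ), inv_mul_cancel_left₀ hδ', mul_assoc (2 * Real.pi : ℂ)⁻¹]
  congr 1
  rw [← integral_mul_const]
  congr 1
  ext ξ
  rw [mul_assoc (χ ξ), ← Complex.exp_add]
  congr 2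
  · field_simp
    ring
  · ring

/-- The `L¹` modulus of continuity of `k`. -/
def transMod (k : ℝ → ℂ) (h : ℝ) : ℝ := ∫ t, ‖k t - k (t - h)‖

lemma transMod_nonneg (k : ℝ → ℂ) (h : ℝ) : 0 ≤ transMod k h :=
  integral_nonneg fun _ => norm_nonneg _

lemma transMod_le {k : ℝ → ℂ} (hk : Integrable k) (h : ℝ) :
    transMod k h ≤ 2 * ∫ t, ‖k t‖ := by
  have h1 : Integrable fun t => k (t - h) := hk.comp_sub_right h
  calc transMod k h ≤ ∫ t, (‖k t‖ + ‖k (t - h)‖) :=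
        integral_mono (hk.sub h1).norm (hk.norm.add h1.norm) fun t => norm_sub_le _ _
    _ = 2 * ∫ t, ‖k t‖ := by
        rw [integral_add hk.norm h1.norm, integral_sub_right_eq_self (fun t => ‖k t‖), two_mul]

lemma measurable_transMod {k : ℝ → ℂ} (hk : Continuous k) : StronglyMeasurable (transMod k) := by
  have : StronglyMeasurable (Function.uncurry fun h t : ℝ => ‖k t - k (t - h)‖) :=
    Continuous.stronglyMeasurable (by
      change Continuous fun p : ℝ × ℝ => ‖k p.2 - k (p.2 - p.1)‖
      fun_prop)
  exact this.integral_prod_right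

lemma tendsto_transMod (k : 𝓢(ℝ, ℂ)) : Tendsto (transMod k) (𝓝 0) (𝓝 0) := by
  obtain ⟨C₀, -, h₀⟩ := k.decay 0 0
  obtain ⟨C₂, -, h₂⟩ := k.decay 2 0
  have hk : ∀ t, ‖k t‖ ≤ (C₀ + C₂) * (1 + t ^ 2)⁻¹ := fun t => by
    have a := h₀ t
    have b := h₂ t
    simp only [pow_zero, one_mul, norm_iteratedFDeriv_zero, Real.norm_eq_abs, sq_abs] at a b
    rw [← div_eq_mul_inv, le_div_iff₀ (by positivity)]
    linarith
  have hC : 0 ≤ C₀ + C₂ := by simpa using (norm_nonneg _).trans (hk 0)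
  have h0 : (0 : ℝ) = ∫ t : ℝ, ‖k t - k (t - 0)‖ := by simp
  conv => enter [3]; rw [h0]
  refine tendsto_integral_filter_of_dominated_convergence
    (fun t => 4 * (C₀ + C₂) * (1 + t ^ 2)⁻¹) (.of_forall fun h => ?_) ?_ ?_ ?_
  · have := k.continuous
    exact Continuous.aestronglyMeasurable (by fun_prop)
  · filter_upwards [Metric.closedBall_mem_nhds (0 : ℝ) one_pos] with h hh
    refine ae_of_all _ fun t => ?_
    rw [norm_norm]
    have hh2 : h ^ 2 ≤ 1 := by
      rw [mem_closedBall_zero_iff, Real.norm_eq_abs] at hh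
      exact (sq_le_one_iff_abs_le_one h).2 hh
    have h3 : (1 + (t - h) ^ 2)⁻¹ ≤ 3 * (1 + t ^ 2)⁻¹ := by
      rw [← div_eq_mul_inv, inv_le_comm₀ (by positivity) (by positivity), inv_div,
        div_le_iff₀ (by norm_num)]
      nlinarith [sq_nonneg (t - 2 * h)]
    calc ‖k t - k (t - h)‖ ≤ ‖k t‖ + ‖k (t - h)‖ := norm_sub_le _ _
      _ ≤ (C₀ + C₂) * (1 + t ^ 2)⁻¹ + (C₀ + C₂) * (3 * (1 + t ^ 2)⁻¹) :=
          add_le_add (hk t) ((hk _).trans (mul_le_mul_of_nonneg_left h3 hC))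
      _ = _ := by ring
  · exact integrable_inv_one_add_sq.const_mul _
  · refine ae_of_all _ fun t => ?_
    have := k.continuous
    exact Continuous.tendsto (f := fun h : ℝ => ‖k t - k (t - h)‖) (by fun_prop) 0

lemma exists_integral_transMod_lt {f : ℝ → ℂ} (hf : Integrable f) (k : 𝓢(ℝ, ℂ)) {c : ℝ}
    (hc : 0 < c) : ∃ δ > 0, ∫ s, ‖f s‖ * transMod k (δ * s) < c := by
  have h1 : Tendsto (fun δ : ℝ => ∫ s, ‖f s‖ * transMod k (δ * s)) (𝓝[>] 0)
      (𝓝 (∫ s : ℝ, ‖f s‖ * 0)) := by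
    refine tendsto_integral_filter_of_dominated_convergence
      (fun s => ‖f s‖ * (2 * ∫ t, ‖k t‖)) (.of_forall fun δ => ?_) (.of_forall fun δ => ?_)
      (hf.norm.mul_const _) (ae_of_all _ fun s => ?_)
    · exact hf.norm.aestronglyMeasurable.mul
        ((measurable_transMod k.continuous).comp_measurable
          (measurable_const_mul δ)).aestronglyMeasurable
    · refine ae_of_all _ fun s => ?_
      rw [norm_mul, norm_norm, Real.norm_of_nonneg (transMod_nonneg _ _)]
      exact mul_le_mul_of_nonneg_left (transMod_le k.integrable _) (norm_nonneg _)
    · refine Tendsto.const_mul _ ((tendsto_transMod k).comp ?_)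
      have : Tendsto (fun δ : ℝ => δ * s) (𝓝 0) (𝓝 (0 * s)) :=
        (continuous_mul_const s).tendsto 0
      rw [zero_mul] at this
      exact this.mono_left nhdsWithin_le_nhds
  simp only [mul_zero, integral_zero] at h1
  obtain ⟨δ, hδ, hpos⟩ := ((h1.eventually (gt_mem_nhds hc)).and self_mem_nhdsWithin).exists
  exact ⟨δ, hpos, hδ⟩

lemma exists_bump (a : ℝ) {r R : ℝ} (hr : 0 < r) (hR : r < R) :
    ∃ φ : ℝ → ℂ, IsTest φ ∧ (∀ ξ ∈ Metric.closedBall a r, φ ξ = 1) ∧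
      tsupport φ ⊆ Metric.closedBall a R := by
  let b : ContDiffBump a := ⟨r, R, hr, hR⟩
  refine ⟨fun ξ => (b ξ : ℂ), ⟨Complex.ofRealCLM.contDiff.comp b.contDiff, ?_⟩, fun ξ hξ => ?_, ?_⟩
  · exact b.hasCompactSupport.comp_left (g := Complex.ofReal) Complex.ofReal_zero
  · simp only [b.one_of_mem_closedBall hξ, Complex.ofReal_one]
  · rw [← show b.rOut = R from rfl, ← b.tsupport_eq]
    exact closure_mono (Function.support_comp_subset Complex.ofReal_zero b)

lemma kern_eq_zero {φ : ℝ → ℂ} (h : ∀ ξ, φ ξ = 0) (u : ℝ) : kern φ u = 0 := by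
  simp [kern, h]

section Dynamics

variable {α : ℝ → X → X}

lemma IsCStarDynSys.norm_le (hα : IsCStarDynSys α) (t : ℝ) (x : X) : ‖α t x‖ ≤ ‖x‖ := by
  let _ : NonUnitalCStarAlgebra X := {}
  have hz : α t 0 = 0 := by simpa using hα.map_smulc t 0 0
  let φ : X →⋆ₙₐ[ℂ] X :=
    { toFun := α t
      map_smul' := hα.map_smulc t
      map_zero' := hz
      map_add' := hα.map_add t
      map_mul' := hα.map_mul t
      map_star' := hα.map_star t }
  exact NonUnitalStarAlgHom.norm_apply_le φ x

/-- The automorphism `α t` as a continuous linear map. -/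
def IsCStarDynSys.actCLM (hα : IsCStarDynSys α) (t : ℝ) : X →L[ℂ] X :=
  LinearMap.mkContinuous
    { toFun := α t
      map_add' := hα.map_add t
      map_smul' := hα.map_smulc t } 1 fun x => by simpa using hα.norm_le t x

@[simp]
lemma IsCStarDynSys.actCLM_apply (hα : IsCStarDynSys α) (t : ℝ) (x : X) :
    hα.actCLM t x = α t x := rfl

lemma IsCStarDynSys.integrable_smul (hα : IsCStarDynSys α) {f : ℝ → ℂ} (hf : Integrable f)
    (x : X) : Integrable fun t => f t • α t x :=
  hf.smul_bdd ‖x‖ (hα.continuous_orbit x).aestronglyMeasurable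
    (ae_of_all _ fun t => hα.norm_le t x)

lemma IsCStarDynSys.norm_smear_le (hα : IsCStarDynSys α) {f : ℝ → ℂ} (hf : Integrable f) (x : X) :
    ‖smear α f x‖ ≤ (∫ t, ‖f t‖) * ‖x‖ := by
  rw [← integral_mul_const]
  refine norm_integral_le_of_norm_le (hf.norm.mul_const _) (ae_of_all _ fun t => ?_)
  rw [norm_smul]
  exact mul_le_mul_of_nonneg_left (hα.norm_le t x) (norm_nonneg _)

/-- `smear α f` as a continuous linear map. -/
def IsCStarDynSys.smearCLM (hα : IsCStarDynSys α) {f : ℝ → ℂ} (hf : Integrable f) : X →L[ℂ] X :=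
  LinearMap.mkContinuous
    { toFun := smear α f
      map_add' := fun x y => by
        simp only [smear, hα.map_add, smul_add]
        exact integral_add (hα.integrable_smul hf x) (hα.integrable_smul hf y)
      map_smul' := fun c x => by
        simp only [smear, hα.map_smulc, smul_comm _ c, RingHom.id_apply]
        exact integral_smul c _ } (∫ t, ‖f t‖) (hα.norm_smear_le hf)

@[simp]
lemma IsCStarDynSys.smearCLM_apply (hα : IsCStarDynSys α) {f : ℝ → ℂ} (hf : Integrable f) (x : X) :
    hα.smearCLM hf x = smear α f x := rfl

lemma IsCStarDynSys.smear_zero (hα : IsCStarDynSys α) {f : ℝ → ℂ} (hf : Integrable f) :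
    smear α f (0 : X) = 0 := (hα.smearCLM hf).map_zero

lemma IsCStarDynSys.act_smear (hα : IsCStarDynSys α) {g : ℝ → ℂ} (hg : Integrable g) (t : ℝ)
    (x : X) : α t (smear α g x) = ∫ s, g (s - t) • α s x := by
  rw [smear, ← hα.actCLM_apply, ← (hα.actCLM t).integral_comp_comm (hα.integrable_smul hg x),
    ← integral_add_left_eq_self (fun u => g (u - t) • α u x) t]
  simp [← hα.map_add_time]

lemma IsCStarDynSys.act_smear_eq_smear_act (hα : IsCStarDynSys α) {g : ℝ → ℂ}
    (hg : Integrable g) (t : ℝ) (x : X) : α t (smear α g x) = smear α g (α t x) := by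
  rw [smear, ← hα.actCLM_apply, ← (hα.actCLM t).integral_comp_comm (hα.integrable_smul hg x),
    smear]
  simp [← hα.map_add_time, add_comm t]

lemma IsCStarDynSys.smear_comm (hα : IsCStarDynSys α) {f g : ℝ → ℂ} (hf : Integrable f)
    (hg : Integrable g) (x : X) : smear α f (smear α g x) = smear α g (smear α f x) := by
  rw [smear]
  simp_rw [hα.act_smear_eq_smear_act hg, ← hα.smearCLM_apply hg, ← (hα.smearCLM hg).map_smul]
  rw [(hα.smearCLM hg).integral_comp_comm (hα.integrable_smul hf x)]
  rfl

lemma integrable_prod_conv {f g : ℝ → ℂ} (hf : Integrable f) (hg : Integrable g) :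
    Integrable (fun p : ℝ × ℝ => f p.1 * g (p.2 - p.1)) (volume.prod volume) :=
  (Integrable.convolution_integrand (ContinuousLinearMap.mul ℂ ℂ) hf hg).swap

lemma IsCStarDynSys.smear_smear (hα : IsCStarDynSys α) {f g : ℝ → ℂ} (hf : Integrable f)
    (hg : Integrable g) (x : X) :
    smear α f (smear α g x) = smear α (fun u => ∫ t, f t * g (u - t)) x := by
  unfold smear
  change ∫ t, f t • α t (smear α g x) = _
  simp_rw [hα.act_smear hg, ← integral_smul, smul_smul, ← integral_smul_const]
  refine integral_integral_swap ?_
  exact (integrable_prod_conv hf hg).smul_bdd ‖x‖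
    ((hα.continuous_orbit x).comp continuous_snd).aestronglyMeasurable
    (ae_of_all _ fun p => hα.norm_le p.2 x)

lemma IsCStarDynSys.smear_smear_kern (hα : IsCStarDynSys α) {f φ : ℝ → ℂ} (hf : Integrable f)
    (hφ : IsTest φ) (x : X) :
    smear α f (smear α (kern φ) x) = smear α (kern fun ξ => fourierT f ξ * φ ξ) x := by
  rw [hα.smear_smear hf hφ.integrable_kern]
  simp_rw [integral_mul_kern_sub hf hφ]

lemma IsCStarDynSys.smear_kern_kern (hα : IsCStarDynSys α) {φ ψ : ℝ → ℂ} (hφ : IsTest φ)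
    (hψ : IsTest ψ) (x : X) :
    smear α (kern φ) (smear α (kern ψ) x) = smear α (kern fun ξ => φ ξ * ψ ξ) x := by
  rw [hα.smear_smear_kern hφ.integrable_kern hψ, hφ.fourierT_kern]

lemma smear_kern_eq_zero {φ : ℝ → ℂ} (h : ∀ ξ, φ ξ = 0) (x : X) : smear α (kern φ) x = 0 := by
  simp [smear, kern_eq_zero h]

lemma IsCStarDynSys.smear_kern_add (hα : IsCStarDynSys α) {φ ψ : ℝ → ℂ} (hφ : IsTest φ)
    (hψ : IsTest ψ) (x : X) :
    smear α (kern fun ξ => φ ξ + ψ ξ) x = smear α (kern φ) x + smear α (kern ψ) x := by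
  simp only [smear, kern_add hφ hψ, add_smul]
  exact integral_add (hα.integrable_smul hφ.integrable_kern x)
    (hα.integrable_smul hψ.integrable_kern x)

lemma IsCStarDynSys.smear_kern_sub (hα : IsCStarDynSys α) {φ ψ : ℝ → ℂ} (hφ : IsTest φ)
    (hψ : IsTest ψ) (x : X) :
    smear α (kern fun ξ => φ ξ - ψ ξ) x = smear α (kern φ) x - smear α (kern ψ) x := by
  simp only [smear, kern_sub hφ hψ, sub_smul]
  exact integral_sub (hα.integrable_smul hφ.integrable_kern x)
    (hα.integrable_smul hψ.integrable_kern x)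

lemma IsCStarDynSys.smear_mul_smear (hα : IsCStarDynSys α) {r q : ℝ → ℂ} {B : ℝ}
    (hr : Integrable r) (hq : Integrable q) (hqc : Continuous q) (hB : ∀ t, ‖q t‖ ≤ B) (x y : X) :
    smear α r (x * smear α q y) = ∫ v, smear α (fun t => r t * q (v - t)) x * α v y := by
  have h1 : ∀ t, r t • α t (x * smear α q y) =
      ∫ v, (r t * q (v - t)) • (α t x * α v y) := fun t => by
    have hi : Integrable fun v => q (v - t) • α v y :=
      hα.integrable_smul (hq.comp_sub_right t) y
    have h2 := (ContinuousLinearMap.mul ℂ X (α t x)).integral_comp_comm hi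
    simp only [ContinuousLinearMap.mul_apply', mul_smul_comm] at h2
    rw [hα.map_mul, hα.act_smear hq, ← h2, ← integral_smul]
    simp_rw [smul_smul]
  have h3 : ∀ v, smear α (fun t => r t * q (v - t)) x * α v y =
      ∫ t, (r t * q (v - t)) • (α t x * α v y) := fun v => by
    have hi : Integrable fun t => (r t * q (v - t)) • α t x :=
      hα.integrable_smul (hr.mul_bdd (c := B) (hqc.comp
        (continuous_const.sub continuous_id)).aestronglyMeasurable (ae_of_all _ fun t => hB _)) x
    have h2 := ((ContinuousLinearMap.mul ℂ X).flip (α v y)).integral_comp_comm hi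
    simp only [ContinuousLinearMap.flip_apply, ContinuousLinearMap.mul_apply', smul_mul_assoc]
      at h2
    rw [smear, ← h2]
  rw [smear]
  simp_rw [h1, h3]
  refine integral_integral_swap ?_
  refine (integrable_prod_conv hr hq).smul_bdd (‖x‖ * ‖y‖) (Continuous.aestronglyMeasurable ?_)
    (ae_of_all _ fun p => ?_)
  · exact ((hα.continuous_orbit x).comp continuous_fst).mul
      ((hα.continuous_orbit y).comp continuous_snd)
  · exact (norm_mul_le _ _).trans (mul_le_mul (hα.norm_le _ _) (hα.norm_le _ _)
      (norm_nonneg _) (norm_nonneg _))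

/-- Dilates of a bump function give an approximate identity. -/
lemma IsCStarDynSys.tendsto_smear_kern (hα : IsCStarDynSys α) {χ : ℝ → ℂ} (hχ : IsTest χ)
    (h1 : χ 0 = 1) (x : X) :
    Tendsto (fun δ : ℝ => smear α (kern fun ξ => χ ((ξ - 0) / δ)) x) atTop (𝓝 x) := by
  have hk : ∫ t, kern χ t • x = x := by
    have : fourierT (kern χ) 0 = 1 := by rw [hχ.fourierT_kern, h1]
    simp only [fourierT, Complex.ofReal_zero, mul_zero, zero_mul, neg_zero, Complex.exp_zero,
      mul_one] at this
    rw [integral_smul_const, this, one_smul]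
  have h2 : Tendsto (fun δ : ℝ => ∫ t, kern χ t • α (t / δ) x) atTop (𝓝 (∫ t, kern χ t • x)) := by
    refine tendsto_integral_filter_of_dominated_convergence (fun t => ‖kern χ t‖ * ‖x‖)
      (.of_forall fun δ => ?_) (.of_forall fun δ => ae_of_all _ fun t => ?_)
      (hχ.integrable_kern.norm.mul_const _) (ae_of_all _ fun t => ?_)
    · exact (hχ.continuous_kern.smul ((hα.continuous_orbit x).comp
        (continuous_id.div_const δ))).aestronglyMeasurable
    · rw [norm_smul]
      exact mul_le_mul_of_nonneg_left (hα.norm_le _ _) (norm_nonneg _)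
    · refine Tendsto.const_smul ?_ _
      have := ((hα.continuous_orbit x).tendsto 0).comp
        (tendsto_const_nhds (x := t).div_atTop tendsto_id)
      rwa [hα.map_zero_time] at this
  rw [hk] at h2
  refine h2.congr' ?_
  filter_upwards [eventually_gt_atTop 0] with δ hδ
  have h3 := Measure.integral_comp_mul_left (fun t : ℝ => kern χ t • α (t / δ) x) δ
  rw [abs_of_pos (inv_pos.2 hδ)] at h3
  rw [smear]
  simp_rw [kern_comp_affine χ 0 hδ, mul_div_cancel_left₀ _ hδ.ne'] at h3 ⊢
  simp only [Complex.ofReal_zero, mul_zero, zero_mul, Complex.exp_zero, mul_one, mul_smul,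
    Complex.coe_smul]
  rw [integral_smul, h3, smul_inv_smul₀ hδ.ne']

/-- A property of localizations which holds locally holds for all test functions supported in a
compact set. -/
lemma IsCStarDynSys.smear_kern_mem_of_locally (hα : IsCStarDynSys α) (M : Submodule ℂ X) (y : X)
    {S : Set ℝ} (hS : IsCompact S)
    (h : ∀ μ ∈ S, ∃ r > 0, ∀ φ, IsTest φ → tsupport φ ⊆ Metric.closedBall μ r →
      smear α (kern φ) y ∈ M) {φ : ℝ → ℂ} (hφ : IsTest φ) (hφS : tsupport φ ⊆ S) :
    smear α (kern φ) y ∈ M := by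
  have key : ∃ θ : ℝ → ℂ, ContDiff ℝ ∞ θ ∧ (∀ ξ ∈ S, θ ξ = 1) ∧
      ∀ φ, IsTest φ → smear α (kern fun ξ => θ ξ * φ ξ) y ∈ M := by
    refine hS.induction_on (p := fun S => ∃ θ : ℝ → ℂ, ContDiff ℝ ∞ θ ∧ (∀ ξ ∈ S, θ ξ = 1) ∧
      ∀ φ, IsTest φ → smear α (kern fun ξ => θ ξ * φ ξ) y ∈ M) ?_ ?_ ?_ ?_
    · refine ⟨fun _ => 0, contDiff_const, by simp, fun φ _ => ?_⟩
      rw [smear_kern_eq_zero (by simp)]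
      exact M.zero_mem
    · rintro s t hst ⟨θ, h1, h2, h3⟩
      exact ⟨θ, h1, fun ξ hξ => h2 ξ (hst hξ), h3⟩
    · rintro s t ⟨θ, h1, h2, h3⟩ ⟨θ', h1', h2', h3'⟩
      refine ⟨fun ξ => θ ξ + θ' ξ - θ ξ * θ' ξ, (h1.add h1').sub (h1.mul h1'), ?_, fun φ hφ => ?_⟩
      · rintro ξ (hξ | hξ)
        · simp [h2 ξ hξ]
        · simp [h2' ξ hξ]
      · have e : (fun ξ => (θ ξ + θ' ξ - θ ξ * θ' ξ) * φ ξ) =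
            fun ξ => (θ ξ * φ ξ + θ' ξ * φ ξ) - θ ξ * (θ' ξ * φ ξ) := by
          ext ξ
          ring
        rw [e, hα.smear_kern_sub ((IsTest.mul_left h1 hφ).add (IsTest.mul_left h1' hφ))
          (IsTest.mul_left h1 (IsTest.mul_left h1' hφ)),
          hα.smear_kern_add (IsTest.mul_left h1 hφ) (IsTest.mul_left h1' hφ)]
        exact M.sub_mem (M.add_mem (h3 _ hφ) (h3' _ hφ)) (h3 _ (IsTest.mul_left h1' hφ))
    · intro μ hμ
      obtain ⟨r, hr, hM⟩ := h μ hμ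
      obtain ⟨θ, h1, h2, h3⟩ := exists_bump μ (half_pos hr) (half_lt_self hr)
      refine ⟨Metric.closedBall μ (r / 2), mem_nhdsWithin_of_mem_nhds
        (Metric.closedBall_mem_nhds μ (half_pos hr)), θ, h1.smooth, h2, fun φ hφ => ?_⟩
      exact hM _ (IsTest.mul_left h1.smooth hφ) ((tsupport_mul_subset_left).trans h3)
  obtain ⟨θ, -, h1, h2⟩ := key
  convert h2 φ hφ using 3
  ext ξ
  by_cases hξ : ξ ∈ tsupport φ
  · rw [h1 ξ (hφS hξ), one_mul]
  · rw [image_eq_zero_of_notMem_tsupport hξ, mul_zero]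

end Dynamics

section Spectrum

variable {α : ℝ → X → X}

lemma norm_kern_le (φ : ℝ → ℂ) (u : ℝ) : ‖kern φ u‖ ≤ ‖(2 * Real.pi : ℂ)⁻¹‖ * ∫ ξ, ‖φ ξ‖ := by
  rw [kern, norm_mul]
  refine mul_le_mul_of_nonneg_left ((norm_integral_le_integral_norm _).trans_eq ?_) (norm_nonneg _)
  simp_rw [norm_mul, norm_exp_I_mul_mul, mul_one]

/-- An element localized at scale `δ` around `γ` is an approximate eigenvector. -/
lemma IsCStarDynSys.norm_act_sub_exp_smul_le (hα : IsCStarDynSys α) {χ : ℝ → ℂ} (hχ : IsTest χ)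
    (γ : ℝ) {δ : ℝ} (hδ : 0 < δ) {u : X}
    (hu : smear α (kern fun ξ => χ ((ξ - γ) / δ)) u = u) (s : ℝ) :
    ‖α s u - Complex.exp (-(Complex.I * γ * s)) • u‖ ≤ transMod (kern χ) (δ * s) * ‖u‖ := by
  set κ := kern fun ξ => χ ((ξ - γ) / δ) with hκ
  have hκi : Integrable κ := (hχ.comp_affine γ hδ).integrable_kern
  have h1 : α s u - Complex.exp (-(Complex.I * γ * s)) • u =
      ∫ t, (κ (t - s) - Complex.exp (-(Complex.I * γ * s)) * κ t) • α t u := by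
    simp_rw [sub_smul, mul_smul]
    rw [integral_sub (hα.integrable_smul (hκi.comp_sub_right s) u)
      ((hα.integrable_smul hκi u).fun_smul _), integral_smul, ← hα.act_smear hκi]
    change _ = α s (smear α κ u) - Complex.exp (-(Complex.I * γ * s)) • smear α κ u
    rw [hu]
  have h2 : ∀ t : ℝ, ‖κ (t - s) - Complex.exp (-(Complex.I * γ * s)) * κ t‖ =
      δ * ‖kern χ (δ * t) - kern χ (δ * t - δ * s)‖ := fun t => by
    rw [hκ, kern_comp_affine χ γ hδ, kern_comp_affine χ γ hδ]
    have e : Complex.exp (Complex.I * γ * ((t - s : ℝ) : ℂ)) =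
        Complex.exp (-(Complex.I * γ * s)) * Complex.exp (Complex.I * γ * t) := by
      rw [← Complex.exp_add]
      congr 1
      push_cast
      ring
    rw [e, show (δ : ℂ) * kern χ (δ * (t - s)) * (Complex.exp (-(Complex.I * γ * s)) *
        Complex.exp (Complex.I * γ * t)) - Complex.exp (-(Complex.I * γ * s)) *
        (δ * kern χ (δ * t) * Complex.exp (Complex.I * γ * t)) =
        δ * (kern χ (δ * t - δ * s) - kern χ (δ * t)) * Complex.exp (-(Complex.I * γ * s)) *
          Complex.exp (Complex.I * γ * t) by rw [mul_sub δ]; ring]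
    rw [norm_mul, norm_mul, norm_mul, norm_exp_I_mul_mul, norm_exp_neg_I_mul_mul, mul_one, mul_one,
      norm_sub_rev, Complex.norm_real, Real.norm_of_nonneg hδ.le]
  have h3 := Measure.integral_comp_mul_left (fun t : ℝ => ‖kern χ t - kern χ (t - δ * s)‖) δ
  rw [abs_of_pos (inv_pos.2 hδ), smul_eq_mul] at h3
  have h4 : ∫ t, ‖κ (t - s) - Complex.exp (-(Complex.I * γ * s)) * κ t‖ =
      transMod (kern χ) (δ * s) := by
    simp_rw [h2]
    rw [integral_const_mul, h3, mul_inv_cancel_left₀ hδ.ne']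
    rfl
  rw [h1, ← h4, ← integral_mul_const]
  refine norm_integral_le_of_norm_le
    (((hκi.comp_sub_right s).sub (hκi.const_mul _)).norm.mul_const _) (ae_of_all _ fun t => ?_)
  rw [norm_smul]
  exact mul_le_mul_of_nonneg_left (hα.norm_le t u) (norm_nonneg _)

/-- Away from its Arveson spectrum, an element has vanishing localizations. -/
lemma IsCStarDynSys.exists_smear_kern_eq_zero (hα : IsCStarDynSys α) {x : X} {γ : ℝ}
    (hγ : γ ∉ elemSpec α x) :
    ∃ δ > 0, ∀ φ, IsTest φ → tsupport φ ⊆ Metric.closedBall γ δ → smear α (kern φ) x = 0 := by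
  simp only [elemSpec, mem_ofPred_eq, not_forall] at hγ
  obtain ⟨f, hf, hfx, hfγ⟩ := hγ
  obtain ⟨χ, hχ, hχ1, -⟩ := exists_bump 0 one_pos one_lt_two
  obtain ⟨k, hk, -⟩ := hχ.exists_schwartz
  obtain ⟨δ, hδ, hlt⟩ := exists_integral_transMod_lt hf k (norm_pos_iff.2 hfγ)
  refine ⟨δ, hδ, fun φ hφ hsupp => ?_⟩
  set u := smear α (kern φ) x with hu
  have hloc : smear α (kern fun ξ => χ ((ξ - γ) / δ)) u = u := by
    rw [hu, hα.smear_kern_kern (hχ.comp_affine γ hδ) hφ]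
    congr 2
    ext ξ
    by_cases hξ : ξ ∈ tsupport φ
    · have := hsupp hξ
      rw [hχ1, one_mul]
      rw [Metric.mem_closedBall, Real.dist_eq] at this ⊢
      rwa [sub_zero, abs_div, abs_of_pos hδ, div_le_one hδ]
    · rw [image_eq_zero_of_notMem_tsupport hξ, mul_zero]
  have hfu : smear α f u = 0 := by
    rw [hu, hα.smear_comm hf hφ.integrable_kern, hfx, hα.smear_zero hφ.integrable_kern]
  have hi : Integrable fun s : ℝ => f s * Complex.exp (-(Complex.I * γ * s)) :=
    hf.mul_bdd (c := 1) (by fun_prop) (ae_of_all _ fun s => (norm_exp_neg_I_mul_mul γ s).le)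
  have h1 : fourierT f γ • u =
      ∫ s, (f s * Complex.exp (-(Complex.I * γ * s))) • u - f s • α s u := by
    rw [integral_sub (hi.smul_const u) (hα.integrable_smul hf u), integral_smul_const]
    change _ = _ - smear α f u
    rw [hfu, sub_zero]
    rfl
  have hb : ∀ s, ‖f s‖ * transMod k (δ * s) ≤ ‖f s‖ * (2 * ∫ t, ‖k t‖) := fun s =>
    mul_le_mul_of_nonneg_left (transMod_le k.integrable _) (norm_nonneg _)
  have hint : Integrable fun s => ‖f s‖ * transMod k (δ * s) := by
    refine (hf.norm.mul_const (2 * ∫ t, ‖k t‖)).mono' (hf.norm.aestronglyMeasurable.mul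
      ((measurable_transMod k.continuous).comp_measurable
        (measurable_const_mul δ)).aestronglyMeasurable) (ae_of_all _ fun s => ?_)
    rw [Real.norm_of_nonneg (mul_nonneg (norm_nonneg _) (transMod_nonneg _ _))]
    exact hb s
  have h2 : ‖fourierT f γ‖ * ‖u‖ ≤ (∫ s, ‖f s‖ * transMod k (δ * s)) * ‖u‖ := by
    rw [← norm_smul, h1, ← integral_mul_const]
    refine norm_integral_le_of_norm_le (hint.mul_const _) (ae_of_all _ fun s => ?_)
    rw [mul_smul, ← smul_sub, norm_smul, norm_sub_rev, hk, mul_assoc ‖f s‖]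
    exact mul_le_mul_of_nonneg_left (hα.norm_act_sub_exp_smul_le hχ γ hδ hloc s) (norm_nonneg (f s))
  by_contra hne
  have hpos : 0 < ‖u‖ := norm_pos_iff.2 hne
  exact absurd (le_of_mul_le_mul_right h2 hpos) (not_le.2 hlt)

lemma IsCStarDynSys.elemSpec_smear_kern_subset (hα : IsCStarDynSys α) {φ : ℝ → ℂ} (hφ : IsTest φ)
    (x : X) : elemSpec α (smear α (kern φ) x) ⊆ tsupport φ := by
  intro γ hγ
  by_contra hn
  obtain ⟨r, hr, hball⟩ := Metric.isOpen_iff.1 (isClosed_tsupport φ).isOpen_compl γ hn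
  obtain ⟨ρ, hρ, h1, h2⟩ := exists_bump γ (r := r / 4) (R := r / 2) (by linarith) (by linarith)
  have h3 := hγ (kern ρ) hρ.integrable_kern ?_
  · rw [hρ.fourierT_kern, h1 γ (Metric.mem_closedBall_self (by linarith))] at h3
    exact one_ne_zero h3
  · rw [hα.smear_kern_kern hρ hφ]
    refine smear_kern_eq_zero (fun ξ => ?_) x
    by_cases hξ : ξ ∈ tsupport ρ
    · have := hball (Metric.closedBall_subset_ball (by linarith) (h2 hξ))
      rw [image_eq_zero_of_notMem_tsupport (f := φ) this, mul_zero]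
    · rw [image_eq_zero_of_notMem_tsupport hξ, zero_mul]

lemma IsCStarDynSys.smear_kern_eq_self (hα : IsCStarDynSys α) {x : X} {a r R : ℝ}
    (hx : x ∈ specC α (Metric.closedBall a r)) (hrR : r < R) {φ : ℝ → ℂ} (hφ : IsTest φ)
    (h1 : ∀ ξ ∈ Metric.closedBall a R, φ ξ = 1) : smear α (kern φ) x = x := by
  obtain ⟨χ, hχ, hχ1, -⟩ := exists_bump 0 one_pos one_lt_two
  have h0 : χ 0 = 1 := hχ1 0 (Metric.mem_closedBall_self zero_le_one)
  refine tendsto_nhds_unique (hα.tendsto_smear_kern hχ h0 _)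
    ((hα.tendsto_smear_kern hχ h0 x).congr' ?_)
  filter_upwards [eventually_gt_atTop 0] with δ hδ
  have hχδ : IsTest fun ξ => χ ((ξ - 0) / δ) := hχ.comp_affine 0 hδ
  rw [hα.smear_kern_kern hχδ hφ, ← sub_eq_zero,
    ← hα.smear_kern_sub hχδ (IsTest.mul_left hχδ.smooth hφ)]
  have ht := hχδ.sub (IsTest.mul_left hχδ.smooth hφ)
  refine (Submodule.mem_bot ℂ).1
    (hα.smear_kern_mem_of_locally ⊥ x ht.compact (fun μ hμ => ?_) ht subset_rfl)
  have hμx : μ ∉ elemSpec α x := fun hmem => by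
    have hμa : μ ∈ Metric.ball a R := Metric.closedBall_subset_ball hrR (hx hmem)
    refine (notMem_tsupport_iff_eventuallyEq.2 ?_) hμ
    filter_upwards [Metric.isOpen_ball.mem_nhds hμa] with ξ hξ
    simp [h1 ξ (Metric.ball_subset_closedBall hξ)]
  obtain ⟨δ', hδ', h⟩ := hα.exists_smear_kern_eq_zero hμx
  exact ⟨δ', hδ', fun φ hφ hs => (Submodule.mem_bot ℂ).2 (h φ hφ hs)⟩

lemma IsCStarDynSys.specC_subset_specO (hα : IsCStarDynSys α) {a r R : ℝ} (hr : 0 < r)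
    (hrR : r < R) {V : Set ℝ} (hV : Metric.closedBall a R ⊆ V) :
    specC α (Metric.closedBall a r) ⊆ specO α (univ : Set X) V := by
  intro x hx
  obtain ⟨φ, hφ, h1, h2⟩ := exists_bump a (r := (r + R) / 2) (R := R) (by linarith) (by linarith)
  refine subset_closure (Submodule.subset_span
    ⟨x, mem_univ x, kern φ, hφ.integrable_kern, ?_, ?_, ?_⟩)
  · rw [hφ.fourierT_kern]
    exact hφ.compact
  · rw [hφ.fourierT_kern]
    exact h2.trans hV
  · exact (hα.smear_kern_eq_self hx (by linarith) hφ h1).symm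

lemma IsCStarDynSys.mul_mem_specC (hα : IsCStarDynSys α) {x y : X} {a b r s t : ℝ} (hr : 0 < r)
    (hs : 0 < s) (hx : x ∈ specC α (Metric.closedBall a r))
    (hy : y ∈ specC α (Metric.closedBall b s)) (hrst : r + s < t) :
    x * y ∈ specC α (Metric.closedBall (a + b) t) := by
  intro γ hγ
  by_contra hn
  obtain ⟨η, hη, ht⟩ : ∃ η > 0, t = r + s + 5 * η := ⟨(t - r - s) / 5, by linarith, by ring⟩
  obtain ⟨φ, hφ, hφ1, hφs⟩ := exists_bump a (r := r + η) (R := r + 2 * η) (by linarith)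
    (by linarith)
  obtain ⟨ψ, hψ, hψ1, hψs⟩ := exists_bump b (r := s + η) (R := s + 2 * η) (by linarith)
    (by linarith)
  obtain ⟨ρ, hρ, hρ1, hρs⟩ := exists_bump γ (half_pos hη) (half_lt_self hη)
  have hxφ := hα.smear_kern_eq_self hx (by linarith) hφ hφ1
  have hyψ := hα.smear_kern_eq_self hy (by linarith) hψ hψ1
  refine one_ne_zero (α := ℂ) ?_
  rw [← hρ1 γ (Metric.mem_closedBall_self (half_pos hη).le), ← congrFun hρ.fourierT_kern γ]
  refine hγ (kern ρ) hρ.integrable_kern ?_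
  rw [← hyψ, hα.smear_mul_smear hρ.integrable_kern hψ.integrable_kern hψ.continuous_kern
    (norm_kern_le ψ)]
  refine integral_eq_zero_of_ae (ae_of_all _ fun v => ?_)
  have hint : Integrable fun t => kern ρ t * kern ψ (v - t) :=
    hρ.integrable_kern.mul_bdd (hψ.continuous_kern.comp
      (continuous_const.sub continuous_id)).aestronglyMeasurable
      (ae_of_all _ fun t => norm_kern_le ψ _)
  suffices h : smear α (fun t => kern ρ t * kern ψ (v - t)) x = 0 by simp [h]
  rw [← hxφ, hα.smear_smear_kern hint hφ]
  refine smear_kern_eq_zero (fun ξ => ?_) x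
  by_cases hξ : ξ ∈ tsupport φ
  swap
  · rw [image_eq_zero_of_notMem_tsupport hξ, mul_zero]
  have hρi : Integrable fun t : ℝ => kern ρ t * Complex.exp (-(Complex.I * ξ * t)) :=
    hρ.integrable_kern.mul_bdd (c := 1) (by fun_prop)
      (ae_of_all _ fun t => (norm_exp_neg_I_mul_mul ξ t).le)
  have e : fourierT (fun t => kern ρ t * kern ψ (v - t)) ξ =
      ∫ t : ℝ, (kern ρ t * Complex.exp (-(Complex.I * ξ * t))) * kern ψ (v - t) := by
    simp only [fourierT, mul_right_comm]
  rw [e, integral_mul_kern_sub hρi hψ, kern_eq_zero, zero_mul]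
  intro ζ
  have e2 : fourierT (fun t : ℝ => kern ρ t * Complex.exp (-(Complex.I * ξ * t))) ζ =
      ρ (ξ + ζ) := by
    rw [← congrFun hρ.fourierT_kern (ξ + ζ)]
    simp only [fourierT, mul_assoc, ← Complex.exp_add]
    congr 1
    ext t
    congr 2
    push_cast
    ring
  rw [e2]
  by_cases hζ : ζ ∈ tsupport ψ
  swap
  · rw [image_eq_zero_of_notMem_tsupport hζ, mul_zero]
  rw [image_eq_zero_of_notMem_tsupport (f := ρ), zero_mul]
  intro hsum
  apply hn
  have h1 := hφs hξ
  have h2 := hψs hζ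
  have h3 := hρs hsum
  rw [Metric.mem_closedBall, Real.dist_eq, abs_le] at h1 h2 h3 ⊢
  constructor <;> linarith [h1.1, h1.2, h2.1, h2.2, h3.1, h3.2]

lemma IsCStarDynSys.star_smear (hα : IsCStarDynSys α) (f : ℝ → ℂ) (x : X) :
    star (smear α f x) = smear α (fun t => star (f t)) (star x) := by
  have h := (starL' ℝ : X ≃L[ℝ] X).integral_comp_comm (μ := volume) (fun t : ℝ => f t • α t x)
  simp only [starL'_apply, star_smul, ← hα.map_star] at h
  exact h.symm

lemma IsCStarDynSys.star_mem_specC (hα : IsCStarDynSys α) {x : X} {a r : ℝ}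
    (hx : x ∈ specC α (Metric.closedBall a r)) : star x ∈ specC α (Metric.closedBall (-a) r) := by
  intro γ hγ
  have h : -γ ∈ elemSpec α x := fun f hf hfx => by
    have h1 := hγ (fun t => star (f t))
      ((starL' ℝ : ℂ ≃L[ℝ] ℂ).toContinuousLinearMap.integrable_comp hf)
      (by rw [← hα.star_smear, hfx, star_zero])
    have h2 : fourierT (fun t => star (f t)) γ = star (fourierT f (-γ)) := by
      have h3 := (starL' ℝ : ℂ ≃L[ℝ] ℂ).integral_comp_comm (μ := volume)
        (fun t : ℝ => f t * Complex.exp (-(Complex.I * ((-γ : ℝ) : ℂ) * t)))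
      simp only [starL'_apply] at h3
      rw [fourierT, fourierT, ← h3]
      congr 1
      ext t
      rw [star_mul', RCLike.star_def, ← Complex.exp_conj]
      simp
    rwa [h2, star_eq_zero] at h1
  have := hx h
  rw [Metric.mem_closedBall, Real.dist_eq] at this ⊢
  rwa [← abs_neg, show -(γ - -a) = -γ - a by ring]

lemma neg_mem_actSpec (hα : IsCStarDynSys α) {γ : ℝ} (hγ : γ ∈ actSpec α (univ : Set X)) :
    -γ ∈ actSpec α (univ : Set X) := by
  intro ε hε h
  apply hγ ε hε
  rw [univ_inter, ← Real.closedBall_eq_Icc] at h ⊢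
  ext x
  rw [mem_singleton_iff]
  refine ⟨fun hx => ?_, fun hx => ?_⟩
  · have : star x ∈ ({0} : Set X) := h ▸ hα.star_mem_specC hx
    exact star_eq_zero.1 this
  · have h0 : (0 : X) ∈ specC α (Metric.closedBall (-γ) ε) := h ▸ mem_singleton (0 : X)
    have := hα.star_mem_specC h0
    rwa [star_zero, neg_neg, ← hx] at this

/-- The spectral subspaces at points of `sp(α)` span a dense subspace. -/
lemma IsCStarDynSys.mem_closure_span_specC (hα : IsCStarDynSys α) {ε : ℝ} (hε : 0 < ε) (y : X) :
    y ∈ (Submodule.span ℂ (⋃ μ ∈ actSpec α (univ : Set X),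
      specC α (Metric.closedBall μ ε))).topologicalClosure := by
  obtain ⟨χ, hχ, hχ1, -⟩ := exists_bump 0 one_pos one_lt_two
  refine (Submodule.isClosed_topologicalClosure _).mem_of_tendsto
    (hα.tendsto_smear_kern hχ (hχ1 0 (Metric.mem_closedBall_self zero_le_one)) y) ?_
  filter_upwards [eventually_gt_atTop 0] with δ hδ
  have hχδ := hχ.comp_affine 0 hδ
  refine Submodule.le_topologicalClosure _ (hα.smear_kern_mem_of_locally _ y hχδ.compact
    (fun μ _ => ?_) hχδ subset_rfl)
  by_cases hμ : μ ∈ actSpec α (univ : Set X)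
  · refine ⟨ε, hε, fun φ hφ hs => Submodule.subset_span (mem_biUnion hμ ?_)⟩
    exact (hα.elemSpec_smear_kern_subset hφ y).trans hs
  · simp only [actSpec, mem_ofPred_eq, not_forall, not_not, univ_inter] at hμ
    obtain ⟨r, hr, h⟩ := hμ
    refine ⟨r, hr, fun φ hφ hs => ?_⟩
    have h0 : smear α (kern φ) y ∈ ({0} : Set X) := by
      rw [← h, ← Real.closedBall_eq_Icc]
      exact (hα.elemSpec_smear_kern_subset hφ y).trans hs
    rw [mem_singleton_iff.1 h0]
    exact Submodule.zero_mem _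

end Spectrum

section ClosedSpans

lemma subset_closedSpan (S : Set X) : S ⊆ ClosedSpan S :=
  Submodule.subset_span.trans subset_closure

lemma map_mem_of_mem_closedSpan {S : Set X} {M : Submodule ℂ X} (hM : IsClosed (M : Set X))
    (L : X →L[ℂ] X) (h : ∀ s ∈ S, L s ∈ M) {x : X} (hx : x ∈ ClosedSpan S) : L x ∈ M := by
  have h1 : Submodule.span ℂ S ≤ M.comap (L : X →ₗ[ℂ] X) := Submodule.span_le.2 h
  have h2 : IsClosed (L ⁻¹' (M : Set X)) := hM.preimage L.continuous
  exact closure_minimal (fun y hy => h1 hy) h2 hx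

/-- Two-sided multiplication `c ↦ p * c * q`. -/
def mulBothCLM (p q : X) : X →L[ℂ] X :=
  ((ContinuousLinearMap.mul ℂ X).flip q).comp (ContinuousLinearMap.mul ℂ X p)

lemma mulBothCLM_apply (p q c : X) : mulBothCLM p q c = p * c * q := rfl

/-- An `α`-simple system is the closed two-sided ideal generated by any nonzero invariant
subset. -/
lemma AlphaSimple.closedSpan_eq_univ {α : ℝ → X → X} (hsimple : AlphaSimple α (univ : Set X))
    (hα : IsCStarDynSys α) {C : Set X} (hinv : Invariant α C) {c : X} (hc : c ∈ C) (hc0 : c ≠ 0) :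
    ClosedSpan (MulSet3 (univ : Set X) C univ) = univ := by
  let N : Submodule ℂ X := (Submodule.span ℂ (MulSet3 (univ : Set X) C univ)).topologicalClosure
  have hN : IsClosed (N : Set X) := Submodule.isClosed_topologicalClosure _
  have hsub : ∀ x ∈ MulSet3 (univ : Set X) C univ, x ∈ N := fun x hx => subset_closedSpan _ hx
  change (N : Set X) = univ
  refine (hsimple N ⟨subset_univ _, hN, N.zero_mem, fun x hx y hy => N.add_mem hx hy,
    fun a x hx => N.smul_mem a hx, fun s _ k hk => ⟨?_, ?_⟩⟩ fun t k hk => ?_).resolve_left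
    fun h => ?_
  · refine map_mem_of_mem_closedSpan hN (ContinuousLinearMap.mul ℂ X s) ?_ hk
    rintro - ⟨y, -, c, hc, z, -, rfl⟩
    exact hsub _ ⟨s * y, mem_univ _, c, hc, z, mem_univ _, by simp [mul_assoc]⟩
  · refine map_mem_of_mem_closedSpan hN ((ContinuousLinearMap.mul ℂ X).flip s) ?_ hk
    rintro - ⟨y, -, c, hc, z, -, rfl⟩
    exact hsub _ ⟨y, mem_univ _, c, hc, z * s, mem_univ _, by simp [mul_assoc]⟩
  · refine map_mem_of_mem_closedSpan hN (hα.actCLM t) ?_ hk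
    rintro - ⟨y, -, c, hc, z, -, rfl⟩
    exact hsub _ ⟨α t y, mem_univ _, α t c, hinv t c hc, α t z, mem_univ _,
      by simp [hα.map_mul]⟩
  · have h1 : star c * c * star c ∈ (N : Set X) :=
      hsub _ ⟨star c, mem_univ _, c, hc, star c, mem_univ _, rfl⟩
    rw [h, mem_singleton_iff] at h1
    have h2 : star (star c * c) * (star c * c) = 0 := by
      rw [star_mul, star_star, ← mul_assoc, h1, zero_mul]
    exact hc0 (CStarRing.star_mul_self_eq_zero_iff c |>.1
      (CStarRing.star_mul_self_eq_zero_iff _ |>.1 h2))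

variable {α : ℝ → X → X} {C : Set X}

lemma mem_closedSpan_mul_right (hmul : ∀ x ∈ C, ∀ y ∈ C, x * y ∈ C) (hstar : ∀ c ∈ C, star c ∈ C)
    {κ ε : ℝ} (hκ : κ ∈ strongSpec α C) (hε : 0 < ε) {c : X} (hc : c ∈ C) :
    c ∈ ClosedSpan (MulSet2 C (C ∩ specC α (Metric.closedBall κ ε))) := by
  rw [← hκ ε hε, ← Real.closedBall_eq_Icc] at hc
  refine closure_mono (Submodule.span_mono ?_) hc
  rintro - ⟨-, ⟨a, ha, rfl⟩, b, hb, d, hd, rfl⟩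
  exact ⟨star a * b, hmul _ (hstar a ha.1) _ hb, d, hd, rfl⟩

lemma mem_closedSpan_mul_left (hα : IsCStarDynSys α) (hmul : ∀ x ∈ C, ∀ y ∈ C, x * y ∈ C)
    (hstar : ∀ c ∈ C, star c ∈ C) {κ ε : ℝ} (hκ : -κ ∈ strongSpec α C) (hε : 0 < ε) {c : X}
    (hc : c ∈ C) : c ∈ ClosedSpan (MulSet2 (C ∩ specC α (Metric.closedBall κ ε)) C) := by
  rw [← hκ ε hε, ← Real.closedBall_eq_Icc] at hc
  refine closure_mono (Submodule.span_mono ?_) hc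
  rintro - ⟨-, ⟨a, ha, rfl⟩, b, hb, d, hd, rfl⟩
  refine ⟨star a, ⟨hstar a ha.1, ?_⟩, b * d, hmul _ hb _ hd.1, mul_assoc _ _ _⟩
  simpa using hα.star_mem_specC ha.2

end ClosedSpans

/-- **Lemma 4.8.** (for `G = ℝ`) Let `(Y, ℝ, α)` be an `α`-simple one-parameter
C*-dynamical system with `sp(α) = Γ̃(α)`. If `C` is a nonzero `α`-invariant hereditary
C*-subalgebra of `Y` and `γ ∈ sp(α)`, then the closed span of `Y^α(V) C Y^α(V)*`
equals `Y` for every open neighborhood `V` of `γ`.  Here the ambient algebra is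
denoted `X`. -/
theorem span_spec_hereditary_eq (α : ℝ → X → X) (hα : IsCStarDynSys α)
    (hsimple : AlphaSimple α (univ : Set X))
    (hsp : actSpec α (univ : Set X) = ConnesSpec α (univ : Set X))
    (C : Set X) (hC : IsHereditaryIn (univ : Set X) C) (hC0 : C ≠ ({0} : Set X))
    (hCinv : Invariant α C)
    (γ : ℝ) (hγ : γ ∈ actSpec α (univ : Set X))
    (V : Set ℝ) (hV : IsOpen V) (hγV : γ ∈ V) :
    ClosedSpan (MulSet3 (specO α (univ : Set X) V) C
      (star '' specO α (univ : Set X) V)) = (univ : Set X) := by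
  have hmul : ∀ x ∈ C, ∀ y ∈ C, x * y ∈ C := hC.2.2.1.1.2.2.2
  have hstar : ∀ c ∈ C, star c ∈ C := hC.2.2.1.2
  obtain ⟨c₀, hc₀, hne⟩ : ∃ c ∈ C, c ≠ 0 := by
    by_contra! h
    exact hC0 (eq_singleton_iff_unique_mem.2 ⟨hC.2.2.1.1.1, h⟩)
  have hstrong : ∀ κ ∈ actSpec α (univ : Set X), κ ∈ strongSpec α C := fun κ hκ => by
    rw [hsp] at hκ
    exact mem_iInter₂.1 hκ C ⟨hC, hC0, hCinv⟩
  obtain ⟨ε, hε, hεV⟩ : ∃ ε > 0, Metric.closedBall γ (6 * ε) ⊆ V := by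
    obtain ⟨R, hR, h⟩ := Metric.nhds_basis_closedBall.mem_iff.1 (hV.mem_nhds hγV)
    exact ⟨R / 6, by positivity, by rwa [mul_div_cancel₀ R (by norm_num)]⟩
  let M : Submodule ℂ X := (Submodule.span ℂ (MulSet3 (specO α (univ : Set X) V) C
    (star '' specO α (univ : Set X) V))).topologicalClosure
  have hM : IsClosed (M : Set X) := Submodule.isClosed_topologicalClosure _
  have hspecO : specC α (Metric.closedBall γ (5 * ε)) ⊆ specO α (univ : Set X) V :=
    hα.specC_subset_specO (by positivity) (by linarith) hεV
  have key : ∀ μ ∈ actSpec α (univ : Set X), ∀ ν ∈ actSpec α (univ : Set X),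
      ∀ x ∈ specC α (Metric.closedBall μ ε), ∀ z ∈ specC α (Metric.closedBall ν ε),
      ∀ c ∈ C, x * c * z ∈ M := by
    intro μ hμ ν hν x hx z hz c hc
    have hμ' : - -μ ∈ strongSpec α C := by rw [neg_neg]; exact hstrong _ hμ
    have hν' : -ν ∈ strongSpec α C := hstrong _ (neg_mem_actSpec hα hν)
    have hγ' : -γ ∈ strongSpec α C := hstrong _ (neg_mem_actSpec hα hγ)
    refine map_mem_of_mem_closedSpan hM (mulBothCLM x z) ?_
      (mem_closedSpan_mul_left hα hmul hstar hμ' hε hc)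
    rintro - ⟨a, ha, b, hb, rfl⟩
    rw [mulBothCLM_apply, ← mul_assoc x]
    refine map_mem_of_mem_closedSpan hM (mulBothCLM (x * a) z) ?_
      (mem_closedSpan_mul_left hα hmul hstar hγ' hε hb)
    rintro - ⟨d, hd, e, he, rfl⟩
    rw [mulBothCLM_apply, ← mul_assoc (x * a)]
    refine map_mem_of_mem_closedSpan hM (mulBothCLM (x * a * d) z) ?_
      (mem_closedSpan_mul_right hmul hstar hν' hε he)
    rintro - ⟨e', he', f, hf, rfl⟩
    rw [mulBothCLM_apply, ← mul_assoc (x * a * d), mul_assoc _ f z]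
    refine map_mem_of_mem_closedSpan hM (mulBothCLM (x * a * d) (f * z)) ?_
      (mem_closedSpan_mul_right hmul hstar hγ' hε he')
    rintro - ⟨b', hb', g, hg, rfl⟩
    rw [mulBothCLM_apply, ← mul_assoc (x * a * d), mul_assoc _ g]
    have h1 : x * a * d ∈ specC α (Metric.closedBall γ (5 * ε)) := by
      have := hα.mul_mem_specC (t := 5 * ε) (by positivity) hε
        (hα.mul_mem_specC (t := 3 * ε) hε hε hx ha.2 (by linarith)) hd.2 (by linarith)
      rwa [add_neg_cancel, zero_add] at this
    have h2 : star (g * (f * z)) ∈ specC α (Metric.closedBall γ (5 * ε)) := by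
      have := hα.star_mem_specC (hα.mul_mem_specC (t := 5 * ε) hε (by positivity) hg.2
        (hα.mul_mem_specC (t := 3 * ε) hε hε hf.2 hz (by linarith)) (by linarith))
      rwa [neg_add_cancel, add_zero, neg_neg] at this
    exact subset_closedSpan _ ⟨_, hspecO h1, b', hb', _, ⟨_, hspecO h2, star_star _⟩, rfl⟩
  have hall : MulSet3 (univ : Set X) C univ ⊆ M := by
    rintro - ⟨y, -, c, hc, z, -, rfl⟩
    refine map_mem_of_mem_closedSpan hM (ContinuousLinearMap.mul ℂ X (y * c)) (fun z hz => ?_)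
      (hα.mem_closure_span_specC hε z)
    obtain ⟨ν, hν, hz⟩ := mem_iUnion₂.1 hz
    refine map_mem_of_mem_closedSpan hM
      (((ContinuousLinearMap.mul ℂ X).flip z).comp ((ContinuousLinearMap.mul ℂ X).flip c))
      (fun y hy => ?_) (hα.mem_closure_span_specC hε y)
    obtain ⟨μ, hμ, hy⟩ := mem_iUnion₂.1 hy
    exact key μ hμ ν hν y hy z hz c hc
  exact eq_univ_of_univ_subset ((hsimple.closedSpan_eq_univ hα hCinv hc₀ hne).symm.subset.trans
    (closure_minimal (Submodule.span_le.2 hall) hM))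

end PeligradMax
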